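/- Let h' = exp(D) be the automorphism (x,y,z) ↦ (x + y + z/2, y + z, z) of C³. If f = (f₁, f₂, f₃) is a polynomial automorphism of C³ commuting with h', then there exist r ∈ ker D, s ∈ C*, and q ∈ ker D such that f₁ = r + sx + qy, f₂ = sy + qz, f₃ = sz. -/

import Mathlib

open MvPolynomial

noncomputable section

/-- The polynomial ring ℂ[x,y,z], with x = X 0, y = X 1, z = X 2. -/
abbrev R3 : Type := MvPolynomial (Fin 3) ℂ

/-- The derivation D = z·∂/∂y + y·∂/∂x, i.e. D x = y, D y = z, D z = 0. -/
def D : Derivation ℂ R3 R3 := mkDerivation ℂ ![X 1, X 2, 0]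

/-- p = xz - (1/2)y² -/
def p : R3 := X 0 * X 2 - C (1/2) * X 1 ^ 2

/-- The exponential automorphism exp(qD) of ℂ³ (for q ∈ ker D), given by its
closed formula: since D q = 0, (qD)x = qy, (qD)²x = q²z, (qD)³x = 0, so
exp(qD) = (x + qy + q²z/2, y + qz, z). -/
def expMap (q : R3) : (Fin 3 → ℂ) → (Fin 3 → ℂ) :=
  fun a => ![a 0 + eval a q * a 1 + eval a q ^ 2 * a 2 / 2,
             a 1 + eval a q * a 2, a 2]

/-- A map ℂ³ → ℂ³ given coordinatewise by polynomials. -/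
def IsPolyMap (F : (Fin 3 → ℂ) → (Fin 3 → ℂ)) : Prop :=
  ∃ f : Fin 3 → R3, ∀ a i, F a i = eval a (f i)

/-- A polynomial automorphism of ℂ³: a polynomial map with a polynomial inverse. -/
def IsPolyAut (F : (Fin 3 → ℂ) → (Fin 3 → ℂ)) : Prop :=
  IsPolyMap F ∧ ∃ G, IsPolyMap G ∧ F ∘ G = id ∧ G ∘ F = id

/-- h' = exp(D) : (x,y,z) ↦ (x + y + z/2, y + z, z). -/
def h'map : (Fin 3 → ℂ) → (Fin 3 → ℂ) :=
  fun a => ![a 0 + a 1 + a 2 / 2, a 1 + a 2, a 2]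

/-- The flow `exp(TD)` of the derivation `D`, with `T` a formal parameter. -/
def flow : R3 →ₐ[ℂ] Polynomial R3 :=
  aeval ![Polynomial.C (X 0) + Polynomial.X * Polynomial.C (X 1)
      + Polynomial.X ^ 2 * Polynomial.C (C (1/2) * X 2),
    Polynomial.C (X 1) + Polynomial.X * Polynomial.C (X 2), Polynomial.C (X 2)]

/-- The comorphism of `h'map`. -/
def h'comap : R3 →ₐ[ℂ] R3 :=
  aeval ![X 0 + X 1 + C (1/2) * X 2, X 1 + X 2, X 2]

lemma eval_h'comap (g : R3) (a : Fin 3 → ℂ) : eval a (h'comap g) = eval (h'map a) g := by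
  induction g using MvPolynomial.induction_on with
  | C c => simp [h'comap]
  | add f g hf hg => simp [hf, hg]
  | mul_X f i hf =>
    rw [map_mul, map_mul, map_mul, hf]
    congr 1
    fin_cases i <;> simp [h'comap, h'map]
    ring

lemma coeff_quadratic {R : Type*} [CommRing R] (a b c : R) :
    (Polynomial.C a + Polynomial.X * Polynomial.C b
        + Polynomial.X ^ 2 * Polynomial.C c).coeff 0 = a ∧
      (Polynomial.C a + Polynomial.X * Polynomial.C b
        + Polynomial.X ^ 2 * Polynomial.C c).coeff 1 = b := by
  constructor <;>
    simp [Polynomial.coeff_X_pow, Polynomial.coeff_C]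

lemma C_half_mul_two : (C (1/2) : R3) * 2 = 1 := by
  rw [show (2 : R3) = C 2 from (map_ofNat C 2).symm, ← C_mul]
  norm_num

lemma flow_C (c : ℂ) : flow (C c) = Polynomial.C (C c) := by
  rw [flow, aeval_C]; rfl

lemma flow_X_zero : flow (X 0) = Polynomial.C (X 0) + Polynomial.X * Polynomial.C (X 1)
    + Polynomial.X ^ 2 * Polynomial.C (C (1/2) * X 2) := by
  simp [flow]

lemma flow_X_one : flow (X 1) = Polynomial.C (X 1) + Polynomial.X * Polynomial.C (X 2) := by
  simp [flow]

lemma flow_X_two : flow (X 2) = Polynomial.C (X 2) := by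
  simp [flow]

lemma coeff_flow {D : Derivation ℂ R3 R3}
    (hx : D (X 0) = X 1) (hy : D (X 1) = X 2) (hz : D (X 2) = 0) (g : R3) :
    (flow g).coeff 0 = g ∧ (flow g).coeff 1 = D g := by
  induction g using MvPolynomial.induction_on with
  | C c =>
    rw [flow_C]
    simp only [Polynomial.coeff_C_zero, true_and, Polynomial.coeff_C_succ]
    exact (D.map_algebraMap c).symm
  | add f g hf hg => simp [hf, hg]
  | mul_X f i hf =>
    have hi : (flow (X i)).coeff 0 = X i ∧ (flow (X i)).coeff 1 = D (X i) := by
      fin_cases i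
      · have := coeff_quadratic (X 0 : R3) (X 1) (C (1/2) * X 2)
        rwa [← flow_X_zero, ← hx] at this
      · simp [flow_X_one, hy, Polynomial.coeff_C]
      · simp [flow_X_two, hz, Polynomial.coeff_C]
    rw [map_mul, Polynomial.mul_coeff_zero, Polynomial.mul_coeff_one, hf.1, hf.2, hi.1, hi.2,
      D.leibniz]
    simp only [smul_eq_mul, true_and]
    ring

lemma eval_natCast_flow_succ (n : ℕ) (g : R3) :
    (flow g).eval ((n + 1 : ℕ) : R3) = h'comap ((flow g).eval (n : R3)) := by
  induction g using MvPolynomial.induction_on with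
  | C c =>
    simp [h'comap]
  | add f g hf hg => simp only [map_add, Polynomial.eval_add, hf, hg]
  | mul_X f i hf =>
    rw [map_mul, Polynomial.eval_mul, Polynomial.eval_mul, map_mul, hf]
    congr 1
    have hC : h'comap (C (1/2)) = C (1/2) := by rw [h'comap, aeval_C]; rfl
    have h0 : h'comap (X 0) = X 0 + X 1 + C (1/2) * X 2 := by simp [h'comap]
    have h1 : h'comap (X 1) = X 1 + X 2 := by simp [h'comap]
    have h2 : h'comap (X 2) = X 2 := by simp [h'comap]
    fin_cases i
    · simp only [Fin.zero_eta, flow_X_zero, Polynomial.eval_add, Polynomial.eval_mul,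
        Polynomial.eval_pow, Polynomial.eval_C, Polynomial.eval_X, map_add, map_mul, map_pow,
        map_natCast, hC, h0, h1, h2, Nat.cast_add, Nat.cast_one]
      linear_combination (n : R3) * X 2 * C_half_mul_two
    · simp only [Fin.mk_one, flow_X_one, Polynomial.eval_add, Polynomial.eval_mul,
        Polynomial.eval_C, Polynomial.eval_X, map_add, map_mul, map_natCast, h1, h2,
        Nat.cast_add, Nat.cast_one]
      ring
    · simp only [Fin.reduceFinMk, flow_X_two, Polynomial.eval_C, h2]

lemma eval_natCast_flow (n : ℕ) (g : R3) : (flow g).eval (n : R3) = h'comap^[n] g := by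
  induction n with
  | zero =>
    have := (coeff_flow (D := D) (by simp [D]) (by simp [D]) (by simp [D]) g).1
    simpa [Polynomial.coeff_zero_eq_eval_zero] using this
  | succ n ih => rw [eval_natCast_flow_succ, ih, Function.iterate_succ_apply']

/-- The flow of `g` is determined by the action of the iterates of `h'map` on `g`. -/
lemma flow_eq_of_iterate {g : R3} {P : Polynomial R3}
    (h : ∀ n : ℕ, h'comap^[n] g = P.eval (n : R3)) : flow g = P := by
  refine Polynomial.eq_of_infinite_eval_eq _ _ ?_
  refine (Set.infinite_range_of_injective (Nat.cast_injective (R := R3))).mono ?_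
  rintro _ ⟨n, rfl⟩
  exact (eval_natCast_flow n g).trans (h n)

lemma eval_eval_flow (g : R3) (t : ℂ) (a : Fin 3 → ℂ) :
    eval a ((flow g).eval (C t)) =
      eval ![a 0 + t * a 1 + t ^ 2 * (1/2 * a 2), a 1 + t * a 2, a 2] g := by
  induction g using MvPolynomial.induction_on with
  | C c => simp
  | add f g hf hg => simp only [map_add, Polynomial.eval_add, hf, hg]
  | mul_X f i hf =>
    rw [map_mul, Polynomial.eval_mul, map_mul, map_mul, hf]
    refine congrArg _ ?_
    fin_cases i
    · simp [flow_X_zero]; ring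
    · simp [flow_X_one]; ring
    · simp [flow_X_two]

/-- An invariant that is the derivative of a polynomial along `D` is divisible by `z`. -/
lemma X_two_dvd_of_flow_eq {g h : R3}
    (hg : flow g = Polynomial.C g + Polynomial.X * Polynomial.C h) : X 2 ∣ h := by
  let σ : R3 →ₐ[ℂ] R3 := aeval ![X 0, -X 1, X 2]
  have hσ (a : Fin 3 → ℂ) (u : R3) : eval a (σ u) = eval ![a 0, -a 1, a 2] u := by
    induction u using MvPolynomial.induction_on with
    | C c => simp [σ]
    | add f g hf hg => simp [hf, hg]
    | mul_X f i hf =>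
      rw [map_mul, map_mul, map_mul, hf]
      congr 1
      fin_cases i <;> simp [σ]
  have key : X 2 * (X 2 * (σ g - g) + 2 * X 1 * h) = 0 := by
    refine MvPolynomial.funext fun a => ?_
    simp only [map_mul, map_add, map_sub, eval_X, map_zero, hσ, map_ofNat]
    by_cases hz : a 2 = 0
    · simp [hz]
    · have := eval_eval_flow g (-2 * a 1 / a 2) a
      rw [hg] at this
      have hv : ![a 0 + -2 * a 1 / a 2 * a 1 + (-2 * a 1 / a 2) ^ 2 * (1/2 * a 2),
          a 1 + -2 * a 1 / a 2 * a 2, a 2] = ![a 0, -a 1, a 2] := by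
        congr 1
        · field_simp; ring
        · congr 1
          field_simp; ring
      rw [hv] at this
      rw [← this]
      simp only [Polynomial.eval_add, Polynomial.eval_mul, Polynomial.eval_C, Polynomial.eval_X,
        map_add, map_mul, eval_C]
      field_simp
      ring
  have h0 := (mul_eq_zero.mp key).resolve_left (X_ne_zero 2)
  have hd : (X 2 : R3) ∣ X 1 * h := by
    refine ⟨-(C (1/2) * (σ g - g)), ?_⟩
    linear_combination C (1/2) * h0 - X 1 * h * C_half_mul_two
  refine ((X_prime (i := 2)).dvd_or_dvd hd).resolve_left fun hd => ?_
  exact absurd (X_dvd_X.mp hd) (by decide)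

lemma flow_of_commute {f₁ f₂ f₃ : R3} {F : (Fin 3 → ℂ) → (Fin 3 → ℂ)}
    (hF : ∀ a, F a = ![eval a f₁, eval a f₂, eval a f₃])
    (hcomm : F ∘ h'map = h'map ∘ F) :
    flow f₃ = Polynomial.C f₃ ∧
    flow f₂ = Polynomial.C f₂ + Polynomial.X * Polynomial.C f₃ ∧
    flow f₁ = Polynomial.C f₁ + Polynomial.X * Polynomial.C f₂
      + Polynomial.X ^ 2 * Polynomial.C (C (1/2) * f₃) := by
  have hc (a : Fin 3 → ℂ) := congrFun hcomm a
  simp only [Function.comp_apply, hF] at hc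
  have h3 : h'comap f₃ = f₃ := MvPolynomial.funext fun a => by
    simpa [h'map, eval_h'comap] using congrFun (hc a) 2
  have h2 : h'comap f₂ = f₂ + f₃ := MvPolynomial.funext fun a => by
    simpa [h'map, eval_h'comap] using congrFun (hc a) 1
  have h1 : h'comap f₁ = f₁ + f₂ + C (1/2) * f₃ := MvPolynomial.funext fun a => by
    have := congrFun (hc a) 0
    simp only [h'map, Matrix.cons_val] at this
    simp only [eval_h'comap, h'map, map_add, map_mul, eval_C, this]
    ring
  have hC : h'comap (C (1/2)) = C (1/2) := by rw [h'comap, aeval_C]; rfl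
  refine ⟨flow_eq_of_iterate fun n => ?_, flow_eq_of_iterate fun n => ?_,
    flow_eq_of_iterate fun n => ?_⟩
  · rw [Polynomial.eval_C, Function.iterate_fixed h3]
  · induction n with
    | zero => simp
    | succ n ih =>
      rw [Function.iterate_succ_apply', ih]
      simp only [Polynomial.eval_add, Polynomial.eval_mul, Polynomial.eval_C, Polynomial.eval_X,
        map_add, map_mul, map_natCast, h2, h3, Nat.cast_add, Nat.cast_one]
      ring
  · induction n with
    | zero => simp
    | succ n ih =>
      rw [Function.iterate_succ_apply', ih]
      simp only [Polynomial.eval_add, Polynomial.eval_mul, Polynomial.eval_C, Polynomial.eval_X,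
        Polynomial.eval_pow, map_add, map_mul, map_pow, map_natCast, h1, h2, h3, hC,
        Nat.cast_add, Nat.cast_one]
      linear_combination (-(n : R3) * f₃) * C_half_mul_two

/-- The third component of an automorphism commuting with `h'map` is a scalar multiple of `z`. -/
lemma exists_eq_C_mul_X_two {f₁ f₂ f₃ : R3} {F : (Fin 3 → ℂ) → (Fin 3 → ℂ)}
    (hF : ∀ a, F a = ![eval a f₁, eval a f₂, eval a f₃])
    (haut : IsPolyAut F) (hcomm : F ∘ h'map = h'map ∘ F) :
    ∃ s : ℂ, s ≠ 0 ∧ f₃ = C s * X 2 := by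
  obtain ⟨-, G, ⟨g, hg⟩, hFG, hGF⟩ := haut
  have hG (a : Fin 3 → ℂ) : G a = ![eval a (g 0), eval a (g 1), eval a (g 2)] := by
    ext i; fin_cases i <;> simp [hg]
  have hcommG : G ∘ h'map = h'map ∘ G := by
    calc G ∘ h'map = G ∘ h'map ∘ (F ∘ G) := by rw [hFG, Function.comp_id]
      _ = G ∘ (F ∘ h'map) ∘ G := by rw [hcomm]; rfl
      _ = (G ∘ F) ∘ h'map ∘ G := rfl
      _ = h'map ∘ G := by rw [hGF, Function.id_comp]
  obtain ⟨u, hu⟩ := X_two_dvd_of_flow_eq (flow_of_commute hF hcomm).2.1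
  obtain ⟨v, hv⟩ := X_two_dvd_of_flow_eq (flow_of_commute hG hcommG).2.1
  have huv : u * aeval ![f₁, f₂, f₃] v = 1 := by
    refine mul_left_cancel₀ (X_ne_zero (R := ℂ) (2 : Fin 3)) (MvPolynomial.funext fun a => ?_)
    have h := congrFun (congrFun hGF a) 2
    have hva : eval a (aeval ![f₁, f₂, f₃] v) = eval (F a) v := by
      rw [aeval_eq_bind₁, ← coe_aeval_eq_eval, ← coe_aeval_eq_eval]
      simp only [RingHom.coe_coe, aeval_bind₁]
      congr 2
      rw [hF]
      ext i; fin_cases i <;> simp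
    have hf : F a 2 = a 2 * eval a u := by simp [hF, hu]
    simp only [Function.comp_apply, hg, hv, map_mul, eval_X, id, hf] at h
    simp only [map_mul, eval_X, hva, mul_one]
    linear_combination h
  obtain ⟨s, hs, rfl⟩ := MvPolynomial.isUnit_iff_eq_C_of_isReduced.mp (IsUnit.of_mul_eq_one _ huv)
  exact ⟨s, hs.ne_zero, by rw [hu, mul_comm]⟩

/-- if the polynomial automorphism f = (f₁, f₂, f₃) of ℂ³ commutes
with h' = exp(D) = (x + y + z/2, y + z, z), then f₁ = r + sx + qy, f₂ = sy + qz,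
f₃ = sz for some r, q ∈ ker D and s ∈ ℂ*. -/
theorem stmt_10 (D : Derivation ℂ R3 R3)
    (hx : D (X 0) = X 1) (hy : D (X 1) = X 2) (hz : D (X 2) = 0)
    (f₁ f₂ f₃ : R3)
    (F : (Fin 3 → ℂ) → (Fin 3 → ℂ))
    (hF : ∀ a, F a = ![eval a f₁, eval a f₂, eval a f₃])
    (haut : IsPolyAut F)
    (hcomm : F ∘ h'map = h'map ∘ F) :
    ∃ r q : R3, D r = 0 ∧ D q = 0 ∧ ∃ s : ℂ, s ≠ 0 ∧
      f₁ = r + C s * X 0 + q * X 1 ∧ f₂ = C s * X 1 + q * X 2 ∧ f₃ = C s * X 2 := by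
  obtain ⟨h3, h2, h1⟩ := flow_of_commute hF hcomm
  obtain ⟨s, hs, rfl⟩ := exists_eq_C_mul_X_two hF haut hcomm
  have hD1 : D f₁ = f₂ := by
    rw [← (coeff_flow hx hy hz f₁).2, h1, (coeff_quadratic _ _ _).2]
  have hD2 : D f₂ = C s * X 2 := by
    rw [← (coeff_flow hx hy hz f₂).2, h2]
    simp [Polynomial.coeff_C]
  have hDC (g : R3) : D (C s * g) = C s * D g := by
    rw [← smul_eq_C_mul, ← smul_eq_C_mul, D.map_smul]
  have hflow : flow (f₁ - C s * X 0) =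
      Polynomial.C (f₁ - C s * X 0) + Polynomial.X * Polynomial.C (f₂ - C s * X 1) := by
    rw [map_sub, map_mul, h1, flow_C, flow_X_zero]
    simp only [map_sub, map_mul]
    ring
  obtain ⟨q, hq⟩ := X_two_dvd_of_flow_eq hflow
  have hDq : D q = 0 := by
    have := congrArg D hq
    rw [map_sub, hDC, hD2, hy, sub_self, D.leibniz, hz, smul_zero, add_zero, smul_eq_mul] at this
    exact (mul_eq_zero.mp this.symm).resolve_left (X_ne_zero 2)
  refine ⟨f₁ - C s * X 0 - q * X 1, q, ?_, hDq, s, hs, by ring, by linear_combination hq, rfl⟩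
  rw [map_sub, map_sub, hDC, D.leibniz, hD1, hx, hy, hDq, smul_zero, add_zero, smul_eq_mul]
  linear_combination hq
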